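/- arXiv:2602.10322 — 3 statements merged into one kernel-verified Lean document; each statement's English description precedes it below -/
import Mathlib

section
/- Every Hamiltonian trajectory on an interval [0,T] whose initial value satisfies x(0) = 0 and ξ(0) = 0 is constant: (x(t), y(t), ξ(t), η(t)) = (0, y(0), 0, η(0)) for all t ∈ [0,T]. In other words, all geodesics of the gas giant metric whose initial condition is cotangent to the boundary are stationary. -/
open Set

noncomputable section

/-- `quadForm M v w = ⟨M v, w⟩`, the bilinear form of the matrix `M` with respect to the
standard inner product on `ℝ^m`. -/
def quadForm {m : ℕ} (M : Matrix (Fin m) (Fin m) ℝ) (v w : Fin m → ℝ) : ℝ :=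
  ∑ i, (∑ j, M i j * v j) * w i

/-- The Euclidean norm of a vector in `ℝ^m`. -/
def euclNorm {m : ℕ} (v : Fin m → ℝ) : ℝ :=
  Real.sqrt (∑ i, v i ^ 2)

/-- Entrywise partial derivative `∂ₓ A` of a matrix-valued map in its first (scalar) variable. -/
def dxA {m : ℕ} (A : ℝ → (Fin m → ℝ) → Matrix (Fin m) (Fin m) ℝ)
    (x : ℝ) (y : Fin m → ℝ) : Matrix (Fin m) (Fin m) ℝ :=
  Matrix.of fun i j => deriv (fun x' => A x' y i j) x

/-- Entrywise partial derivative `∂_{y k} A` of a matrix-valued map in the `k`-th component of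
its second (vector) variable. -/
def dyA {m : ℕ} (A : ℝ → (Fin m → ℝ) → Matrix (Fin m) (Fin m) ℝ)
    (k : Fin m) (x : ℝ) (y : Fin m → ℝ) : Matrix (Fin m) (Fin m) ℝ :=
  Matrix.of fun i j => deriv (fun s => A x (Function.update y k s) i j) (y k)

/-- Partial derivative `∂ₓ f` of a scalar function of `(x, y)`. -/
def dxF {m : ℕ} (f : ℝ → (Fin m → ℝ) → ℝ) (x : ℝ) (y : Fin m → ℝ) : ℝ :=
  deriv (fun x' => f x' y) x

/-- Partial derivative `∂_{y k} f` of a scalar function of `(x, y)`. -/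
def dyF {m : ℕ} (f : ℝ → (Fin m → ℝ) → ℝ) (k : Fin m) (x : ℝ) (y : Fin m → ℝ) : ℝ :=
  deriv (fun s => f x (Function.update y k s)) (y k)

/-- Iterated partial derivative `∂ₓ^k f` of a scalar function of `(x, y)`. -/
def dxIter {m : ℕ} : ℕ → (ℝ → (Fin m → ℝ) → ℝ) → ℝ → (Fin m → ℝ) → ℝ
  | 0, f => f
  | (k+1), f => dxF (dxIter k f)

/-- The standing hypotheses on the data of a gas giant in `g`-boundary normal coordinates:
`n ≥ 2`, `ε ∈ (0,1]`, `U ⊆ ℝ^{n-1}` open, and `A : [0,ε) × U → ℝ^{(n-1)×(n-1)}` symmetric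
positive definite (with uniform ellipticity constants `0 < lam ≤ Lam`), extending to a `C^∞`
map on an open neighborhood of `[0,ε) × U`, with all first-order partial derivatives of all
entries bounded by `Lam`.  (`A` plays the role of the inverse boundary metric `h^{ij}` of the
gas giant metric `g = dx² + x⁻² h(x,y,dy)`.) -/
structure GasGiantData (n : ℕ) (ε : ℝ) (U : Set (Fin (n-1) → ℝ))
    (A : ℝ → (Fin (n-1) → ℝ) → Matrix (Fin (n-1)) (Fin (n-1)) ℝ)
    (lam Lam : ℝ) : Prop where
  hn : 2 ≤ n
  hε : ε ∈ Set.Ioc (0:ℝ) 1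
  hU : IsOpen U
  hlam : 0 < lam
  hlamLam : lam ≤ Lam
  hsymm : ∀ x ∈ Set.Ico (0:ℝ) ε, ∀ y ∈ U, (A x y).IsSymm
  hsmooth : ∃ W : Set (ℝ × (Fin (n-1) → ℝ)), IsOpen W ∧ Set.Ico (0:ℝ) ε ×ˢ U ⊆ W ∧
    ∀ i j, ContDiffOn ℝ (⊤ : ℕ∞) (fun p : ℝ × (Fin (n-1) → ℝ) => A p.1 p.2 i j) W
  hposdef : ∀ x ∈ Set.Ico (0:ℝ) ε, ∀ y ∈ U, ∀ v : Fin (n-1) → ℝ,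
    lam * (∑ i, v i ^ 2) ≤ quadForm (A x y) v v ∧ quadForm (A x y) v v ≤ Lam * (∑ i, v i ^ 2)
  hderivBound : ∀ x ∈ Set.Ico (0:ℝ) ε, ∀ y ∈ U,
    (∀ i j, |dxA A x y i j| ≤ Lam) ∧ (∀ k i j, |dyA A k x y i j| ≤ Lam)

/-- A Hamiltonian trajectory on the interval `I` for the gas giant Hamiltonian
`H(x,y,ξ,η) = ½ ξ² + ½ x² ⟨A(x,y)η, η⟩`: a `C¹` curve
`t ↦ (x(t), y(t), ξ(t), η(t)) ∈ [0,ε) × U × ℝ × ℝ^{n-1}` satisfying Hamilton's equations. -/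
structure IsHamTraj (n : ℕ) (ε : ℝ) (U : Set (Fin (n-1) → ℝ))
    (A : ℝ → (Fin (n-1) → ℝ) → Matrix (Fin (n-1)) (Fin (n-1)) ℝ) (I : Set ℝ)
    (x : ℝ → ℝ) (y : ℝ → Fin (n-1) → ℝ) (ξ : ℝ → ℝ) (η : ℝ → Fin (n-1) → ℝ) : Prop where
  mem : ∀ t ∈ I, x t ∈ Set.Ico (0:ℝ) ε ∧ y t ∈ U
  hx : ∀ t ∈ I, HasDerivAt x (ξ t) t
  hy : ∀ t ∈ I, ∀ i, HasDerivAt (fun t' => y t' i)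
    ((x t)^2 * ∑ j, A (x t) (y t) i j * η t j) t
  hxi : ∀ t ∈ I, HasDerivAt ξ
    (-(x t * quadForm (A (x t) (y t)) (η t) (η t))
      - (1/2) * (x t)^2 * quadForm (dxA A (x t) (y t)) (η t) (η t)) t
  heta : ∀ t ∈ I, ∀ i, HasDerivAt (fun t' => η t' i)
    (-(1/2) * (x t)^2 * quadForm (dyA A i (x t) (y t)) (η t) (η t)) t

/-- A short-geodesic trajectory with data `(y₀, η₀, s)`: a Hamiltonian trajectory on `[0,T]`,
`T > 0`, with initial value `(0, y₀, s, η₀)`, with `x(T) = 0` and `x(t) > 0` on `(0,T)`. -/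
def IsShortGeo (n : ℕ) (ε : ℝ) (U : Set (Fin (n-1) → ℝ))
    (A : ℝ → (Fin (n-1) → ℝ) → Matrix (Fin (n-1)) (Fin (n-1)) ℝ)
    (y₀ η₀ : Fin (n-1) → ℝ) (s T : ℝ)
    (x : ℝ → ℝ) (y : ℝ → Fin (n-1) → ℝ) (ξ : ℝ → ℝ) (η : ℝ → Fin (n-1) → ℝ) : Prop :=
  0 < T ∧ IsHamTraj n ε U A (Set.Icc 0 T) x y ξ η ∧
    x 0 = 0 ∧ y 0 = y₀ ∧ ξ 0 = s ∧ η 0 = η₀ ∧ x T = 0 ∧ ∀ t ∈ Set.Ioo 0 T, 0 < x t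

/-- A bilinear form whose matrix has entries bounded by `C` is bounded by `C` times the product of
the `ℓ¹` norms. -/
lemma abs_quadForm_le {m : ℕ} {M : Matrix (Fin m) (Fin m) ℝ} {C : ℝ}
    (hM : ∀ i j, |M i j| ≤ C) (v w : Fin m → ℝ) :
    |quadForm M v w| ≤ C * (∑ j, |v j|) * ∑ i, |w i| := by
  unfold quadForm
  rw [Finset.mul_sum]
  refine (Finset.abs_sum_le_sum_abs _ _).trans (Finset.sum_le_sum fun i _ => ?_)
  rw [abs_mul, Finset.mul_sum]
  refine mul_le_mul_of_nonneg_right ?_ (abs_nonneg _)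
  refine (Finset.abs_sum_le_sum_abs _ _).trans (Finset.sum_le_sum fun j _ => ?_)
  rw [abs_mul]
  exact mul_le_mul_of_nonneg_right (hM i j) (abs_nonneg _)

/-- Uniqueness for second-order scalar equations `x'' = f` with `|f| ≤ K |x|` and zero
Cauchy data. -/
lemma eq_zero_of_abs_deriv_deriv_le {x ξ f : ℝ → ℝ} {K T : ℝ}
    (hx : ∀ t ∈ Icc 0 T, HasDerivAt x (ξ t) t) (hξ : ∀ t ∈ Icc 0 T, HasDerivAt ξ (f t) t)
    (hf : ∀ t ∈ Icc 0 T, |f t| ≤ K * |x t|) (hx0 : x 0 = 0) (hξ0 : ξ 0 = 0) :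
    ∀ t ∈ Icc 0 T, x t = 0 ∧ ξ t = 0 := by
  have hd : ∀ t ∈ Icc 0 T, HasDerivAt (fun s => (x s, ξ s)) (ξ t, f t) t :=
    fun t ht => (hx t ht).prodMk (hξ t ht)
  have key := eq_zero_of_abs_deriv_le_mul_abs_self_of_eq_zero_right
    (f := fun s => (x s, ξ s)) (f' := fun s => (ξ s, f s)) (K := max 1 K) (a := 0) (b := T)
    (fun t ht => (hd t ht).continuousAt.continuousWithinAt)
    (fun t ht => (hd t (Ico_subset_Icc_self ht)).hasDerivWithinAt)
    (by simp [hx0, hξ0])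
    (fun t ht => by
      have hft := hf t (Ico_subset_Icc_self ht)
      simp only [Prod.norm_def, Real.norm_eq_abs]
      have h1 : (0 : ℝ) ≤ max 1 K := zero_le_one.trans (le_max_left _ _)
      refine max_le ?_ ?_
      · calc |ξ t| ≤ 1 * max |x t| |ξ t| := by rw [one_mul]; exact le_max_right _ _
          _ ≤ _ := mul_le_mul_of_nonneg_right (le_max_left _ _)
            ((abs_nonneg _).trans (le_max_left _ _))
      · calc |f t| ≤ K * |x t| := hft
          _ ≤ max 1 K * |x t| := mul_le_mul_of_nonneg_right (le_max_right _ _) (abs_nonneg _)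
          _ ≤ _ := mul_le_mul_of_nonneg_left (le_max_left _ _) h1)
  intro t ht
  simpa using key t ht

/-- A function on `[0, T]` with vanishing derivative is constant. -/
lemma eq_initial_of_hasDerivAt_zero {f : ℝ → ℝ} {T : ℝ}
    (hf : ∀ t ∈ Icc 0 T, HasDerivAt f 0 t) : ∀ t ∈ Icc 0 T, f t = f 0 :=
  constant_of_has_deriv_right_zero
    (fun t ht => (hf t ht).continuousAt.continuousWithinAt)
    (fun t ht => (hf t (Ico_subset_Icc_self ht)).hasDerivWithinAt)

/-- a Hamiltonian trajectory on `[0,T]` whose initial condition is cotangent to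
the boundary (`x(0) = 0`, `ξ(0) = 0`) is stationary. -/
theorem stmt_1 (n : ℕ) (ε : ℝ) (U : Set (Fin (n-1) → ℝ))
    (A : ℝ → (Fin (n-1) → ℝ) → Matrix (Fin (n-1)) (Fin (n-1)) ℝ) (lam Lam : ℝ)
    (hGG : GasGiantData n ε U A lam Lam)
    (T : ℝ) (hT : 0 ≤ T)
    (x : ℝ → ℝ) (y : ℝ → Fin (n-1) → ℝ) (ξ : ℝ → ℝ) (η : ℝ → Fin (n-1) → ℝ)
    (hTraj : IsHamTraj n ε U A (Set.Icc 0 T) x y ξ η)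
    (hx0 : x 0 = 0) (hxi0 : ξ 0 = 0) :
    ∀ t ∈ Set.Icc (0:ℝ) T, x t = 0 ∧ y t = y 0 ∧ ξ t = 0 ∧ η t = η 0 := by
  have hη : ∀ i, ContinuousOn (fun t => η t i) (Icc 0 T) :=
    fun i t ht => (hTraj.heta t ht i).continuousAt.continuousWithinAt
  obtain ⟨C, hC⟩ := isCompact_Icc.bddAbove_image
    (f := fun t => (∑ i, η t i ^ 2) + (∑ i, |η t i|) * ∑ i, |η t i|)
    (ContinuousOn.add (continuousOn_finsetSum _ fun i _ => (hη i).pow 2)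
      ((continuousOn_finsetSum _ fun i _ => (hη i).abs).mul
        (continuousOn_finsetSum _ fun i _ => (hη i).abs)))
  have hLam : 0 ≤ Lam := hGG.hlam.le.trans hGG.hlamLam
  have hzero : ∀ t ∈ Icc 0 T, x t = 0 ∧ ξ t = 0 := by
    refine eq_zero_of_abs_deriv_deriv_le (K := Lam * C) hTraj.hx hTraj.hxi (fun t ht => ?_)
      hx0 hxi0
    obtain ⟨hxt, hyt⟩ := hTraj.mem t ht
    have hA := hGG.hposdef _ hxt _ hyt (η t)
    have hD := abs_quadForm_le (hGG.hderivBound _ hxt _ hyt).1 (η t) (η t)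
    have hCt : (∑ i, η t i ^ 2) + (∑ i, |η t i|) * ∑ i, |η t i| ≤ C :=
      hC (mem_image_of_mem _ ht)
    have hS : 0 ≤ ∑ i, η t i ^ 2 := Finset.sum_nonneg fun i _ => sq_nonneg _
    have hA0 : 0 ≤ quadForm (A (x t) (y t)) (η t) (η t) :=
      (mul_nonneg hGG.hlam.le hS).trans hA.1
    have hx1 : x t ≤ 1 := hxt.2.le.trans hGG.hε.2
    have hLC := mul_le_mul_of_nonneg_left hCt hLam
    generalize quadForm (A (x t) (y t)) (η t) (η t) = a at *
    generalize quadForm (dxA A (x t) (y t)) (η t) (η t) = d at *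
    have hfac : -(x t * a) - (1 / 2) * (x t) ^ 2 * d = -((a + (1 / 2) * x t * d) * x t) := by ring
    rw [hfac, abs_neg, abs_mul]
    refine mul_le_mul_of_nonneg_right ?_ (abs_nonneg _)
    have hxd : |1 / 2 * x t * d| ≤ |d| := by
      rw [abs_mul]
      refine mul_le_of_le_one_left (abs_nonneg _) ?_
      rw [abs_le]
      constructor <;> linarith [hxt.1]
    calc |a + 1 / 2 * x t * d| ≤ |a| + |1 / 2 * x t * d| := abs_add_le _ _
      _ ≤ a + |d| := by rw [abs_of_nonneg hA0]; linarith
      _ ≤ Lam * C := by linarith [hA.2]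
  intro t ht
  refine ⟨(hzero t ht).1, funext fun i => ?_, (hzero t ht).2, funext fun i => ?_⟩
  · refine eq_initial_of_hasDerivAt_zero (f := fun s => y s i) (fun s hs => ?_) t ht
    simpa [(hzero s hs).1] using hTraj.hy s hs i
  · refine eq_initial_of_hasDerivAt_zero (f := fun s => η s i) (fun s hs => ?_) t ht
    simpa [(hzero s hs).1] using hTraj.heta s hs i
end
end

section
/- There exist ε′ ∈ (0,ε] and C > 0, depending only on n, λ, Λ, with the following property. Let t ↦ (x(t),y(t),ξ(t),η(t)) be a Hamiltonian trajectory on [0,T] of unit speed, i.e. ξ(t)² + x(t)²⟨A(x(t),y(t))η(t), η(t)⟩ = 1, with x(0) = x₀ ∈ (0,ε′), ξ(0) ≤ 0, x(t) > 0 for t ∈ [0,T), x(T) = 0, and suppose additionally that ⟨A(x(t),y(t))η(t), η(t)⟩ ≤ 2 for all t ∈ [0,T]. Then the exit time satisfies |T − x₀| ≤ C x₀³. -/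
open Set

noncomputable section

/-- A function on `[0, T]` with derivative `ξ`, where `ξ 0 ≤ 0` and `ξ` does not vanish at points
whose `x`-value is at most `x 0`, keeps a negative derivative throughout `[0, T]`. -/
lemma neg_deriv_of_ne_zero_below {T : ℝ} {x ξ : ℝ → ℝ}
    (hx : ∀ t ∈ Icc 0 T, HasDerivAt x (ξ t) t) (hξ : ContinuousOn ξ (Icc 0 T)) (h0 : ξ 0 ≤ 0)
    (hne : ∀ t ∈ Icc 0 T, x t ≤ x 0 → ξ t ≠ 0) : ∀ t ∈ Icc 0 T, ξ t < 0 := by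
  intro t ht
  by_contra! hcon
  have hcomp : IsCompact (Icc 0 T ∩ ξ ⁻¹' {0}) :=
    isCompact_Icc.of_isClosed_subset
      (hξ.preimage_isClosed_of_isClosed isClosed_Icc isClosed_singleton) inter_subset_left
  have hivt : ∀ s ∈ Icc 0 T, 0 ≤ ξ s → ∃ r ∈ Icc 0 s, ξ r = 0 := fun s hs hpos =>
    intermediate_value_Icc hs.1 (hξ.mono (Icc_subset_Icc_right hs.2)) ⟨h0, hpos⟩
  obtain ⟨r, hr, hr0⟩ := hivt t ht hcon
  obtain ⟨t₁, ⟨ht₁, hz⟩, hmin⟩ :=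
    hcomp.exists_isLeast ⟨r, ⟨hr.1, hr.2.trans ht.2⟩, hr0⟩
  have hsub : ∀ s ∈ Icc 0 t₁, s ∈ Icc 0 T := fun s hs => ⟨hs.1, hs.2.trans ht₁.2⟩
  have hanti : AntitoneOn x (Icc 0 t₁) := by
    refine antitoneOn_of_deriv_nonpos (convex_Icc 0 t₁)
      (fun s hs => (hx s (hsub s hs)).continuousAt.continuousWithinAt)
      (fun s hs => (hx s (hsub s (interior_subset hs))).differentiableAt.differentiableWithinAt)
      (fun s hs => ?_)
    rw [interior_Icc] at hs
    have hs' := hsub s (Ioo_subset_Icc_self hs)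
    rw [(hx s hs').deriv]
    by_contra! hpos
    obtain ⟨q, hq, hq0⟩ := hivt s hs' hpos.le
    have := hmin ⟨⟨hq.1, hq.2.trans hs'.2⟩, hq0⟩
    linarith [hq.2, hs.2]
  exact hne t₁ ht₁ (hanti (left_mem_Icc.2 ht₁.1) (right_mem_Icc.2 ht₁.1) ht₁.1) hz

/-- asymptotics of the exit time of a unit-speed descending geodesic:
`|T − x₀| ≤ C x₀³`, with `ε'` and `C` depending only on `n`, `lam`, `Lam`. -/
theorem stmt_5 (n : ℕ) (hn : 2 ≤ n) (lam Lam : ℝ) (hlam : 0 < lam) (hll : lam ≤ Lam) :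
    ∃ ε' > (0:ℝ), ∃ C > (0:ℝ),
      ∀ (ε : ℝ) (U : Set (Fin (n-1) → ℝ))
        (A : ℝ → (Fin (n-1) → ℝ) → Matrix (Fin (n-1)) (Fin (n-1)) ℝ),
        GasGiantData n ε U A lam Lam →
        ∀ (T : ℝ), 0 ≤ T →
        ∀ (x : ℝ → ℝ) (y : ℝ → Fin (n-1) → ℝ) (ξ : ℝ → ℝ) (η : ℝ → Fin (n-1) → ℝ),
          IsHamTraj n ε U A (Set.Icc 0 T) x y ξ η →
          (∀ t ∈ Set.Icc (0:ℝ) T,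
            ξ t ^ 2 + (x t)^2 * quadForm (A (x t) (y t)) (η t) (η t) = 1) →
          x 0 ∈ Set.Ioo (0:ℝ) (min ε' ε) → ξ 0 ≤ 0 →
          (∀ t ∈ Set.Ico (0:ℝ) T, 0 < x t) → x T = 0 →
          (∀ t ∈ Set.Icc (0:ℝ) T, quadForm (A (x t) (y t)) (η t) (η t) ≤ 2) →
          |T - x 0| ≤ C * (x 0)^3 := by
  refine ⟨1 / 2, by norm_num, 4, by norm_num, ?_⟩
  intro ε U A hA T hT x y ξ η hγ hunit hx0 hξ0 hpos hxT hq
  obtain ⟨hx0pos, hx0lt⟩ := hx0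
  have hx0half : x 0 < 1 / 2 := hx0lt.trans_le (min_le_left _ _)
  have hTpos : 0 < T := by
    rcases hT.eq_or_lt with h | h
    · rw [← h] at hxT
      linarith
    · exact h
  have hlow : ∀ t ∈ Icc 0 T, x t ≤ x 0 → 1 - 2 * x 0 ^ 2 ≤ ξ t ^ 2 := by
    intro t ht hle
    have hsq : x t ^ 2 ≤ x 0 ^ 2 := pow_le_pow_left₀ (hγ.mem t ht).1.1 hle 2
    have := mul_le_mul_of_nonneg_left (hq t ht) (sq_nonneg (x t))
    linarith [hunit t ht]
  have hup : ∀ t ∈ Icc 0 T, ξ t ^ 2 ≤ 1 := by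
    intro t ht
    have hnonneg : 0 ≤ quadForm (A (x t) (y t)) (η t) (η t) :=
      (mul_nonneg hlam.le (Finset.sum_nonneg fun i _ => sq_nonneg (η t i))).trans
        (hA.hposdef _ (hγ.mem t ht).1 _ (hγ.mem t ht).2 (η t)).1
    linarith [hunit t ht, mul_nonneg (sq_nonneg (x t)) hnonneg]
  have hneg := neg_deriv_of_ne_zero_below hγ.hx
    (fun t ht => (hγ.hxi t ht).continuousAt.continuousWithinAt) hξ0
    (fun t ht hle hz => by
      have := hlow t ht hle
      rw [hz] at this
      nlinarith)
  have hxcont : ContinuousOn x (Icc 0 T) :=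
    fun s hs => (hγ.hx s hs).continuousAt.continuousWithinAt
  have hanti : AntitoneOn x (Icc 0 T) := by
    refine antitoneOn_of_deriv_nonpos (convex_Icc 0 T) hxcont
      (fun s hs => (hγ.hx s (interior_subset hs)).differentiableAt.differentiableWithinAt)
      (fun s hs => ?_)
    rw [(hγ.hx s (interior_subset hs)).deriv]
    exact (hneg s (interior_subset hs)).le
  obtain ⟨c, hc, hslope⟩ := exists_hasDerivAt_eq_slope x ξ hTpos hxcont
    (fun s hs => hγ.hx s (Ioo_subset_Icc_self hs))
  have hc' := Ioo_subset_Icc_self hc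
  have hslope' : x 0 = -ξ c * T := by
    rw [hxT, sub_zero, zero_sub, eq_div_iff hTpos.ne'] at hslope
    linarith
  have hcneg := hneg c hc'
  have hc1 : -ξ c ≤ 1 := by nlinarith [hup c hc']
  have hc2 : 1 - 2 * x 0 ^ 2 ≤ -ξ c := by
    nlinarith [hlow c hc' (hanti (left_mem_Icc.2 hT) hc' hc'.1)]
  have hle : x 0 ≤ T := by nlinarith
  have hge : (1 - 2 * x 0 ^ 2) * T ≤ x 0 := by nlinarith
  have hsq : x 0 ^ 2 ≤ 1 / 4 := by nlinarith
  have hT2 : T ≤ 2 * x 0 := by nlinarith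
  rw [abs_of_nonneg (sub_nonneg.2 hle)]
  nlinarith [mul_le_mul_of_nonneg_left hT2 (sq_nonneg (x 0))]
end
end

section
/- Assume in addition that ∂_x A ≡ 0 on [0,ε) × U (so that the h-norm ⟨A η, η⟩ is a constant of motion for the geodesic flow). Then there exists ε′ > 0, depending only on n, λ, Λ, such that every short-geodesic trajectory with data (y₀, η₀, s) with 0 < s < ε′ has exit time exactly T = π, and consequently its g-length equals s·π. -/
open Set

noncomputable section

/-- Chain rule along a curve `t ↦ (x t, y t)`, written with the partial derivatives `dxF`
and `dyF`. -/
theorem hasDerivAt_comp_curve {m : ℕ} {f : ℝ → (Fin m → ℝ) → ℝ} {x : ℝ → ℝ}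
    {y : ℝ → Fin m → ℝ} {x' : ℝ} {y' : Fin m → ℝ} {t : ℝ}
    (hf : DifferentiableAt ℝ (fun p : ℝ × (Fin m → ℝ) => f p.1 p.2) (x t, y t))
    (hx : HasDerivAt x x' t) (hy : ∀ i, HasDerivAt (fun t' => y t' i) (y' i) t) :
    HasDerivAt (fun t' => f (x t') (y t'))
      (dxF f (x t) (y t) * x' + ∑ k, dyF f k (x t) (y t) * y' k) t := by
  set L := fderiv ℝ (fun p : ℝ × (Fin m → ℝ) => f p.1 p.2) (x t, y t) with hL
  have hfL : HasFDerivAt (fun p : ℝ × (Fin m → ℝ) => f p.1 p.2) L (x t, y t) :=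
    hf.hasFDerivAt
  have hdx : dxF f (x t) (y t) = L (1, 0) := by
    have hline : HasDerivAt (fun r => (r, y t)) (1, 0) (x t) :=
      (hasDerivAt_id' (x t)).prodMk (hasDerivAt_const _ (y t))
    exact (hfL.comp_hasDerivAt (x t) hline).deriv
  have hdy (k : Fin m) : dyF f k (x t) (y t) = L (0, Pi.single k 1) := by
    have hup : HasDerivAt (fun s => (x t, Function.update (y t) k s)) (0, Pi.single k 1)
        (y t k) := (hasDerivAt_const _ (x t)).prodMk (hasDerivAt_update (y t) k (y t k))
    have hfL' : HasFDerivAt (fun p : ℝ × (Fin m → ℝ) => f p.1 p.2) L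
        (x t, Function.update (y t) k (y t k)) := by
      rwa [Function.update_eq_self]
    exact (hfL'.comp_hasDerivAt (y t k) hup).deriv
  have hcurve := hfL.comp_hasDerivAt t (hx.prodMk (hasDerivAt_pi.2 hy))
  refine hcurve.congr_deriv ?_
  have hdecomp : ((x', y') : ℝ × (Fin m → ℝ)) =
      x' • (1, 0) + ∑ k, y' k • ((0 : ℝ), (Pi.single k 1 : Fin m → ℝ)) := by
    ext j
    · simp [Prod.fst_sum]
    · simp [Prod.snd_sum, Finset.sum_apply, Pi.single_apply]
  rw [hdecomp, map_add, map_smul, map_sum, hdx]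
  simp only [map_smul, smul_eq_mul, hdy, mul_comm]

/-- Derivative of the quadratic form of a symmetric matrix along a curve. -/
theorem hasDerivAt_quadForm_self {m : ℕ} {M : ℝ → Matrix (Fin m) (Fin m) ℝ}
    {M' : Matrix (Fin m) (Fin m) ℝ} {v : ℝ → Fin m → ℝ} {v' : Fin m → ℝ} {t : ℝ}
    (hsymm : (M t).IsSymm) (hM : ∀ i j, HasDerivAt (fun t' => M t' i j) (M' i j) t)
    (hv : ∀ i, HasDerivAt (fun t' => v t' i) (v' i) t) :
    HasDerivAt (fun t' => quadForm (M t') (v t') (v t'))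
      (quadForm M' (v t) (v t) + 2 * quadForm (M t) (v t) v') t := by
  have h := HasDerivAt.fun_sum (u := Finset.univ) fun i _ =>
    (HasDerivAt.fun_sum (u := Finset.univ) fun j _ => (hM i j).fun_mul (hv j)).fun_mul (hv i)
  refine h.congr_deriv ?_
  have hswap : ∑ i, (∑ j, M t i j * v' j) * v t i = ∑ i, (∑ j, M t i j * v t j) * v' i := by
    simp only [Finset.sum_mul]
    rw [Finset.sum_comm]
    refine Finset.sum_congr rfl fun i _ => Finset.sum_congr rfl fun j _ => ?_
    rw [hsymm.apply i j]
    ring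
  simp only [quadForm, Finset.sum_add_distrib, add_mul, hswap]
  ring

/-- If `∂ₓA` vanishes, then `⟨A η, η⟩` is a constant of motion. -/
theorem IsHamTraj.hasDerivAt_quadForm {n : ℕ} {ε lam Lam : ℝ} {U : Set (Fin (n-1) → ℝ)}
    {A : ℝ → (Fin (n-1) → ℝ) → Matrix (Fin (n-1)) (Fin (n-1)) ℝ} {I : Set ℝ}
    {x : ℝ → ℝ} {y : ℝ → Fin (n-1) → ℝ} {ξ : ℝ → ℝ} {η : ℝ → Fin (n-1) → ℝ}
    (h : IsHamTraj n ε U A I x y ξ η) (hA : GasGiantData n ε U A lam Lam)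
    (hdx : ∀ x ∈ Set.Ico (0:ℝ) ε, ∀ y ∈ U, dxA A x y = 0) {t : ℝ} (ht : t ∈ I) :
    HasDerivAt (fun t' => quadForm (A (x t') (y t')) (η t') (η t')) 0 t := by
  obtain ⟨hxt, hyt⟩ := h.mem t ht
  obtain ⟨W, hW, hsub, hsmooth⟩ := hA.hsmooth
  have hdiff (i j) : DifferentiableAt ℝ (fun p : ℝ × (Fin (n-1) → ℝ) => A p.1 p.2 i j)
      (x t, y t) :=
    ((hsmooth i j).contDiffAt (hW.mem_nhds (hsub ⟨hxt, hyt⟩))).differentiableAt (by simp)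
  set y' : Fin (n-1) → ℝ := fun k => (x t)^2 * ∑ j, A (x t) (y t) k j * η t j with hy'
  have hM (i j) : HasDerivAt (fun t' => A (x t') (y t') i j)
      ((∑ k, y' k • dyA A k (x t) (y t)) i j) t := by
    refine (hasDerivAt_comp_curve (f := fun x y => A x y i j) (hdiff i j) (h.hx t ht)
      (h.hy t ht)).congr_deriv ?_
    have h0 : dxF (fun x y => A x y i j) (x t) (y t) = 0 :=
      congrFun (congrFun (hdx _ hxt _ hyt) i) j
    rw [h0, zero_mul, zero_add, Matrix.sum_apply]
    exact Finset.sum_congr rfl fun k _ => mul_comm _ _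
  refine (hasDerivAt_quadForm_self (M := fun t' => A (x t') (y t')) (hA.hsymm _ hxt _ hyt) hM
    (h.heta t ht)).congr_deriv ?_
  have hsum : quadForm (∑ k, y' k • dyA A k (x t) (y t)) (η t) (η t)
      = ∑ k, y' k * quadForm (dyA A k (x t) (y t)) (η t) (η t) := by
    simp only [quadForm, Matrix.sum_apply, Matrix.smul_apply, smul_eq_mul, Finset.sum_mul,
      Finset.mul_sum]
    rw [Finset.sum_comm_cycle]
    refine Finset.sum_congr rfl fun k _ => Finset.sum_congr rfl fun i _ =>
      Finset.sum_congr rfl fun j _ => ?_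
    ring
  rw [hsum, quadForm, Finset.mul_sum, ← Finset.sum_add_distrib]
  refine Finset.sum_eq_zero fun k _ => ?_
  simp only [hy']
  ring

theorem eq_left_of_hasDerivAt_zero {f : ℝ → ℝ} {T : ℝ}
    (hf : ∀ t ∈ Set.Icc 0 T, HasDerivAt f 0 t) {t : ℝ} (ht : t ∈ Set.Icc 0 T) : f t = f 0 :=
  constant_of_has_deriv_right_zero (fun r hr => (hf r hr).continuousAt.continuousWithinAt)
    (fun r hr => (hf r (Set.Ico_subset_Icc_self hr)).hasDerivWithinAt) t ht

/-- The solution of `x'' = -x`, `x(0) = 0`, `x'(0) = s` on `[0,T]` is `s sin t`. -/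
theorem eq_mul_sin_of_hasDerivAt {x ξ : ℝ → ℝ} {s T : ℝ}
    (hx : ∀ t ∈ Set.Icc 0 T, HasDerivAt x (ξ t) t)
    (hξ : ∀ t ∈ Set.Icc 0 T, HasDerivAt ξ (-x t) t) (hx0 : x 0 = 0) (hξ0 : ξ 0 = s)
    {t : ℝ} (ht : t ∈ Set.Icc 0 T) : x t = s * Real.sin t := by
  have hE : ∀ r ∈ Set.Icc 0 T, HasDerivAt
      (fun r => (x r - s * Real.sin r)^2 + (ξ r - s * Real.cos r)^2) 0 r := fun r hr => by
    refine (((((hx r hr).fun_sub ((Real.hasDerivAt_sin r).const_mul s)).fun_pow 2).fun_add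
      (((hξ r hr).fun_sub ((Real.hasDerivAt_cos r).const_mul s)).fun_pow 2))).congr_deriv ?_
    push_cast
    ring
  have h := eq_left_of_hasDerivAt_zero hE ht
  simp only [hx0, hξ0, Real.sin_zero, Real.cos_zero] at h
  nlinarith [sq_nonneg (x t - s * Real.sin t), sq_nonneg (ξ t - s * Real.cos t)]


/-- if `∂ₓA ≡ 0` (so the `h`-norm is a constant of motion), then every short
geodesic with small enough speed `s` has exit time exactly `T = π`, hence `g`-length `s·π`;
the threshold `ε'` depends only on `n`, `lam`, `Lam`. -/
theorem stmt_11 (n : ℕ) (hn : 2 ≤ n) (lam Lam : ℝ) (hlam : 0 < lam) (hll : lam ≤ Lam) :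
    ∃ ε' > (0:ℝ),
      ∀ (ε : ℝ) (U : Set (Fin (n-1) → ℝ))
        (A : ℝ → (Fin (n-1) → ℝ) → Matrix (Fin (n-1)) (Fin (n-1)) ℝ),
        GasGiantData n ε U A lam Lam →
        (∀ x ∈ Set.Ico (0:ℝ) ε, ∀ y ∈ U, dxA A x y = 0) →
        ∀ (y₀ η₀ : Fin (n-1) → ℝ) (s T : ℝ)
          (x : ℝ → ℝ) (y : ℝ → Fin (n-1) → ℝ) (ξ : ℝ → ℝ) (η : ℝ → Fin (n-1) → ℝ),
          y₀ ∈ U → quadForm (A 0 y₀) η₀ η₀ = 1 → 0 < s → s < ε' →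
          IsShortGeo n ε U A y₀ η₀ s T x y ξ η →
          T = Real.pi ∧ s * T = s * Real.pi := by
  refine ⟨1, one_pos, fun ε U A hA hdx y₀ η₀ s T x y ξ η _ hη₀ hs _ hgeo => ?_⟩
  obtain ⟨hT, htraj, hx0, hy0, hξ0, hη0, hxT, hpos⟩ := hgeo
  have hK : ∀ t ∈ Set.Icc 0 T, quadForm (A (x t) (y t)) (η t) (η t) = 1 := fun t ht => by
    rw [eq_left_of_hasDerivAt_zero (fun r hr => htraj.hasDerivAt_quadForm hA hdx hr) ht, hx0,
      hy0, hη0, hη₀]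
  have hξ : ∀ t ∈ Set.Icc 0 T, HasDerivAt ξ (-x t) t := fun t ht => by
    obtain ⟨hxt, hyt⟩ := htraj.mem t ht
    refine (htraj.hxi t ht).congr_deriv ?_
    rw [hK t ht, hdx _ hxt _ hyt]
    simp [quadForm]
  have hsin : ∀ t ∈ Set.Icc 0 T, x t = s * Real.sin t := fun t ht =>
    eq_mul_sin_of_hasDerivAt htraj.hx hξ hx0 hξ0 ht
  have hTpi : T = Real.pi := by
    rcases lt_trichotomy T Real.pi with hlt | heq | hgt
    · have h := hsin T (Set.right_mem_Icc.2 hT.le)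
      have := mul_pos hs (Real.sin_pos_of_pos_of_lt_pi hT hlt)
      linarith
    · exact heq
    · have h := hsin Real.pi ⟨Real.pi_pos.le, hgt.le⟩
      have := hpos Real.pi ⟨Real.pi_pos, hgt⟩
      rw [Real.sin_pi, mul_zero] at h
      linarith
  exact ⟨hTpi, by rw [hTpi]⟩
end
end
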